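/- arXiv:1908.07838 — 2 statements merged into one kernel-verified Lean document; each statement's English description precedes it below -/
import Mathlib

section
/- Fix m ≥ 2, a bounded open connected set Ω ⊂ ℝ^m, an integer d ≥ 5, smooth vector fields V̂_1,…,V̂_d : ℝ^m → ℝ^m, and a tolerance ε > 0. Then there exist smooth vector fields V_1,…,V_d : ℝ^m → ℝ^m with sup_{x∈Ω} ‖V_i(x) − V̂_i(x)‖ < ε for all i = 1,…,d, such that the controlled system with vector fields V_1,…,V_d together with the readout y = λ(X^x_1 − x) forms a universal interpolator for generic training data: for every N ∈ ℕ there is a Lebesgue nullset 𝒩_N ⊂ Ω^N such that for every (x_1,…,x_N) ∈ Ω^N ∖ 𝒩_N and every tuple of pairwise distinct y_1,…,y_N ∈ Ω there exist λ > 0 and smooth controls u^1,…,u^d : [0,1] → ℝ with y_i = λ(X^{x_i}_1 − x_i) for all i, where X^{x_i} solves d/dt X_t = Σ_{j=1}^d u^j_t V_j(X_t) with X_0 = x_i. -/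
open Set MeasureTheory

noncomputable section

/-- The matching property for the readout `y = λ(X^x_1 − x)`. -/
def MatchesWithReadout {m d N : ℕ}
    (V : Fin d → EuclideanSpace ℝ (Fin m) → EuclideanSpace ℝ (Fin m))
    (xbar y : Fin N → EuclideanSpace ℝ (Fin m)) : Prop :=
  ∃ lam : ℝ, 0 < lam ∧
    ∃ u : Fin d → ℝ → ℝ,
      (∀ j, ContDiff ℝ (⊤ : ℕ∞) (u j)) ∧
      ∀ i, ∃ X : ℝ → EuclideanSpace ℝ (Fin m),
        X 0 = xbar i ∧
        (∀ t ∈ Set.Icc (0:ℝ) 1, HasDerivAt X (∑ j, u j t • V j (X t)) t) ∧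
        y i = lam • (X 1 - xbar i)

theorem AnalyticOnNhd.ae_ne_zero_of_real {g : ℝ → ℝ} (hg : AnalyticOnNhd ℝ g univ) {a : ℝ}
    (ha : g a ≠ 0) : ∀ᵐ t, g t ≠ 0 := by
  have h := hg.eqOn_zero_or_eventually_ne_zero_of_preconnected isPreconnected_univ
  have h' := h.resolve_left fun h0 => ha (h0 (mem_univ a))
  have h2 := ae_restrict_le_codiscreteWithin (μ := volume) MeasurableSet.univ h'
  rw [Measure.restrict_univ] at h2
  exact h2

/-- The zero set of a real analytic function that does not vanish identically is a null set. -/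
theorem AnalyticOnNhd.measure_setOf_eq_zero {F : Type*} [NormedAddCommGroup F] [NormedSpace ℝ F]
    [FiniteDimensional ℝ F] [MeasurableSpace F] [BorelSpace F] (μ : Measure F)
    [μ.IsAddHaarMeasure] {f : F → ℝ} (hf : AnalyticOnNhd ℝ f univ) {p : F} (hp : f p ≠ 0) :
    μ {x | f x = 0} = 0 := by
  have hfc : Continuous f := continuousOn_univ.1 hf.continuousOn
  have hline : ∀ x : F, ∀ᵐ t : ℝ, f (p + t • x) ≠ 0 := by
    intro x
    refine AnalyticOnNhd.ae_ne_zero_of_real (g := fun t => f (p + t • x)) (a := 0) ?_ (by simpa)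
    refine hf.comp (fun t _ => ?_) (mapsTo_univ _ _)
    fun_prop
  have hmeas : MeasurableSet {z : F × ℝ | f (p + z.2 • z.1) = 0} :=
    (isClosed_eq (by fun_prop) continuous_const).measurableSet
  have hprod : ∀ᵐ z ∂(μ.prod (volume : Measure ℝ)), f (p + z.2 • z.1) ≠ 0 := by
    rw [ae_iff]
    simp only [ne_eq, not_not]
    rw [Measure.measure_prod_null hmeas]
    refine Filter.Eventually.of_forall fun x => ?_
    simpa [ae_iff] using hline x
  have hswap : ∀ᵐ z ∂((volume : Measure ℝ).prod μ), f (p + z.1 • z.2) ≠ 0 := by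
    rw [← Measure.prod_swap, ae_map_iff measurable_swap.aemeasurable]
    · exact hprod
    · exact ((isClosed_eq (by fun_prop) continuous_const).measurableSet).compl
  have hne : ∀ᵐ t : ℝ, t ≠ 0 := by simp [ae_iff]
  obtain ⟨t, ht, ht0⟩ := ((Measure.ae_ae_of_ae_prod hswap).and hne).exists
  have h1 : μ ((fun x => t • x) ⁻¹' ((fun x => p + x) ⁻¹' {x | f x = 0})) = 0 := by
    simpa [ae_iff] using ht
  rw [Measure.addHaar_preimage_smul μ ht0, measure_preimage_add] at h1
  simpa [ht0] using h1

theorem exists_analyticOnNhd_near_real {E : Type*} [NormedAddCommGroup E] [NormedSpace ℝ E]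
    {K : Set E} (hK : IsCompact K) {f : E → ℝ} (hf : Continuous f) {ε : ℝ} (hε : 0 < ε) :
    ∃ g : E → ℝ, AnalyticOnNhd ℝ g univ ∧ ∀ x ∈ K, |g x - f x| < ε := by
  have := isCompact_iff_compactSpace.1 hK
  let A : Subalgebra ℝ C(K, ℝ) :=
    { carrier := {h | ∃ g : E → ℝ, AnalyticOnNhd ℝ g univ ∧ ∀ x : K, h x = g x}
      mul_mem' := by
        rintro _ _ ⟨g, hg, h⟩ ⟨g', hg', h'⟩
        exact ⟨g * g', hg.mul hg', fun x => by simp [h, h']⟩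
      add_mem' := by
        rintro _ _ ⟨g, hg, h⟩ ⟨g', hg', h'⟩
        exact ⟨g + g', hg.add hg', fun x => by simp [h, h']⟩
      algebraMap_mem' := fun r => ⟨fun _ => r, analyticOnNhd_const, fun x => by simp⟩ }
  have hA : A.SeparatesPoints := by
    intro x y hxy
    obtain ⟨φ, hφ⟩ := SeparatingDual.exists_separating_of_ne (R := ℝ) (Subtype.coe_injective.ne hxy)
    exact ⟨_, ⟨⟨fun z : K => φ z, by fun_prop⟩, ⟨φ, φ.analyticOnNhd _, fun _ => rfl⟩, rfl⟩, hφ⟩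
  obtain ⟨⟨h, g, hg, hhg⟩, hn⟩ :=
    ContinuousMap.exists_mem_subalgebra_near_continuous_of_separatesPoints A hA
      (fun x : K => f x) (by fun_prop) ε hε
  refine ⟨g, hg, fun x hx => ?_⟩
  have := hn ⟨x, hx⟩
  simpa [hhg] using this

theorem exists_analyticOnNhd_near {E : Type*} [NormedAddCommGroup E] [NormedSpace ℝ E] {m : ℕ}
    {K : Set E} (hK : IsCompact K) {f : E → EuclideanSpace ℝ (Fin m)} (hf : Continuous f)
    {ε : ℝ} (hε : 0 < ε) :
    ∃ g : E → EuclideanSpace ℝ (Fin m), AnalyticOnNhd ℝ g univ ∧ ∀ x ∈ K, ‖g x - f x‖ < ε := by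
  obtain ⟨C, hC0, hC⟩ : ∃ C : ℝ, 0 < C ∧ ∀ v : Fin m → ℝ, ‖WithLp.toLp 2 v‖ ≤ C * ‖v‖ := by
    have := (EuclideanSpace.equiv (Fin m) ℝ).symm.toContinuousLinearMap.isBoundedLinearMap.bound
    simpa using this
  have h : ∀ j : Fin m, ∃ g : E → ℝ, AnalyticOnNhd ℝ g univ ∧
      ∀ x ∈ K, |g x - f x j| < ε / (2 * C) := fun j =>
    exists_analyticOnNhd_near_real hK (f := fun x => f x j) (by fun_prop) (by positivity)
  choose g hg hgf using h
  refine ⟨fun x => WithLp.toLp 2 fun j => g j x, ?_, fun x hx => ?_⟩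
  · have h1 : AnalyticOnNhd ℝ (fun x j => g j x) univ := AnalyticOnNhd.pi hg
    exact ((EuclideanSpace.equiv (Fin m) ℝ).symm.toContinuousLinearMap.analyticOnNhd univ).comp h1
      (mapsTo_univ _ _)
  · have h2 : ‖(fun j => g j x - f x j)‖ ≤ ε / (2 * C) :=
      (pi_norm_le_iff_of_nonneg (by positivity)).2 fun j => (hgf j x hx).le
    have h3 : WithLp.toLp 2 (fun j => g j x) - f x = WithLp.toLp 2 (fun j => g j x - f x j) := by
      ext j; simp
    rw [h3]
    calc _ ≤ C * (ε / (2 * C)) := (hC _).trans (by gcongr)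
      _ = ε / 2 := by field_simp
      _ < ε := by linarith

/-- The iterated Lie brackets `[V, [V, … [V, W]]]`. -/
def iterLieBracket {F : Type*} [NormedAddCommGroup F] [NormedSpace ℝ F] (V W : F → F) : ℕ → F → F
  | 0 => W
  | k + 1 => VectorField.lieBracket ℝ V (iterLieBracket V W k)

theorem AnalyticOnNhd.iterLieBracket {F : Type*} [NormedAddCommGroup F] [NormedSpace ℝ F]
    [CompleteSpace F] {V W : F → F} (hV : AnalyticOnNhd ℝ V univ) (hW : AnalyticOnNhd ℝ W univ)
    (k : ℕ) : AnalyticOnNhd ℝ (iterLieBracket V W k) univ := by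
  induction k with
  | zero => exact hW
  | succ k ih =>
    have h : ∀ {A B : F → F}, AnalyticOnNhd ℝ A univ → AnalyticOnNhd ℝ B univ →
        AnalyticOnNhd ℝ (fun x => fderiv ℝ A x (B x)) univ := fun hA hB x hx =>
      ((ContinuousLinearMap.id ℝ (F →L[ℝ] F)).analyticAt_bilinear (fderiv ℝ _ x, _)).comp₂
        (hA.fderiv x hx) (hB x hx)
    exact (h ih hV).sub (h hV ih)

theorem iterLieBracket_congr {F : Type*} [NormedAddCommGroup F] [NormedSpace ℝ F]
    {V W V' W' : F → F} {x : F} (hV : V =ᶠ[nhds x] V') (hW : W =ᶠ[nhds x] W') (k : ℕ) :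
    iterLieBracket V W k =ᶠ[nhds x] iterLieBracket V' W' k := by
  induction k with
  | zero => exact hW
  | succ k ih => exact hV.lieBracket_vectorField ih

theorem ContDiff.iterLieBracket {F : Type*} [NormedAddCommGroup F] [NormedSpace ℝ F]
    {V W : F → F} (hV : ContDiff ℝ (⊤ : ℕ∞) V) (hW : ContDiff ℝ (⊤ : ℕ∞) W) (k : ℕ) :
    ContDiff ℝ (⊤ : ℕ∞) (iterLieBracket V W k) := by
  induction k with
  | zero => exact hW
  | succ k ih => exact hV.lieBracket_vectorField ih le_rfl

theorem iterLieBracket_prod {F : Type*} [NormedAddCommGroup F] [NormedSpace ℝ F]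
    [CompleteSpace F] {V W : ℝ × F → F} (hV : AnalyticOnNhd ℝ V univ)
    (hW : AnalyticOnNhd ℝ W univ) (k : ℕ) (z : ℝ × F) :
    iterLieBracket (fun z => ((0 : ℝ), V z)) (fun z => ((0 : ℝ), W z)) k z =
      (0, iterLieBracket (fun x => V (z.1, x)) (fun x => W (z.1, x)) k z.2) := by
  have hc : ∀ {A : ℝ × F → F}, AnalyticOnNhd ℝ A univ →
      AnalyticOnNhd ℝ (fun z => ((0 : ℝ), A z)) univ := fun hA => analyticOnNhd_const.prod hA
  have hfd : ∀ {A : ℝ × F → F} (δ : ℝ) (x v : F), DifferentiableAt ℝ A (δ, x) →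
      fderiv ℝ (fun z => ((0 : ℝ), A z)) (δ, x) (0, v) =
        (0, fderiv ℝ (fun y => A (δ, y)) x v) := by
    intro A δ x v hA
    have h1 := ((hasFDerivAt_const (0 : ℝ) (δ, x)).prodMk hA.hasFDerivAt).fderiv
    have h2 := (hA.hasFDerivAt.comp x (hasFDerivAt_prodMk_right δ x)).fderiv
    rw [h1]
    change _ = (0, fderiv ℝ (A ∘ fun y => (δ, y)) x v)
    rw [h2]
    simp
  induction k generalizing z with
  | zero => rfl
  | succ k ih =>
    obtain ⟨δ, x⟩ := z
    set B := fun z => (iterLieBracket (fun z => ((0 : ℝ), V z)) (fun z => ((0 : ℝ), W z)) k z).2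
      with hB
    have hBan : AnalyticOnNhd ℝ B univ := fun z hz =>
      ((ContinuousLinearMap.snd ℝ ℝ F).analyticAt _).comp ((hc hV).iterLieBracket (hc hW) k z hz)
    have h1 : iterLieBracket (fun z => ((0 : ℝ), V z)) (fun z => ((0 : ℝ), W z)) k =
        fun z => (0, B z) := by
      funext z
      simp [hB, ih z]
    have h2 : iterLieBracket (fun x => V (δ, x)) (fun x => W (δ, x)) k = fun x => B (δ, x) := by
      funext y
      rw [hB]
      simp only [ih]
    simp only [iterLieBracket, VectorField.lieBracket, h1, h2]
    rw [hfd δ x _ (hBan _ (mem_univ _)).differentiableAt,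
      hfd δ x _ (hV _ (mem_univ _)).differentiableAt]
    simp

theorem hasDerivAt_iterLieBracket_const {F : Type*} [NormedAddCommGroup F] [NormedSpace ℝ F]
    [CompleteSpace F] {W : F → F} (hW : AnalyticOnNhd ℝ W univ) (v x : F) (p : F →L[ℝ] ℝ)
    (k : ℕ) (t : ℝ) :
    HasDerivAt (fun t : ℝ => p (iterLieBracket (fun _ => v) W k (x + t • v)))
      (p (iterLieBracket (fun _ => v) W (k + 1) (x + t • v))) t := by
  have h1 := ((analyticOnNhd_const (v := v)).iterLieBracket hW k (x + t • v)
    (mem_univ _)).differentiableAt.hasFDerivAt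
  have h2 : HasDerivAt (fun t : ℝ => x + t • v) v t := by
    simpa using ((hasDerivAt_id t).smul_const v).const_add x
  have h3 := p.hasFDerivAt.comp_hasDerivAt t (h1.comp_hasDerivAt t h2)
  simpa [iterLieBracket, VectorField.lieBracket, Function.comp_def] using h3

theorem eq_zero_of_iterLieBracket_const {F : Type*} [NormedAddCommGroup F] [NormedSpace ℝ F]
    [CompleteSpace F] {W : F → F} (hW : AnalyticOnNhd ℝ W univ) (v x : F) (p : F →L[ℝ] ℝ)
    (h : ∀ k, p (iterLieBracket (fun _ => v) W k x) = 0) (t : ℝ) : p (W (x + t • v)) = 0 := by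
  set g : ℕ → ℝ → ℝ := fun k t => p (iterLieBracket (fun _ => v) W k (x + t • v)) with hg
  have hd : ∀ k, iteratedDeriv k (g 0) = g k := by
    intro k
    induction k with
    | zero => simp
    | succ k ih =>
      rw [iteratedDeriv_succ, ih]
      funext t
      exact (hasDerivAt_iterLieBracket_const hW v x p k t).deriv
  have hga : AnalyticOnNhd ℝ (g 0) univ := by
    refine (p.analyticOnNhd univ).comp (hW.comp (fun t _ => ?_) (mapsTo_univ _ _)) (mapsTo_univ _ _)
    fun_prop
  have htop : analyticOrderAt (g 0) 0 = ⊤ := by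
    refine ENat.eq_top_iff_forall_ge.2 fun n => ?_
    rw [natCast_le_analyticOrderAt_iff_iteratedDeriv_eq_zero (hga 0 (mem_univ _))]
    intro i _
    rw [hd i]
    simpa [hg] using h i
  have := hga.eq_of_eventuallyEq (g := fun _ => 0) analyticOnNhd_const (z₀ := 0)
    (analyticOrderAt_eq_top.1 htop)
  exact congrFun this t

/-- The values at `x` of the iterated brackets `[V, [V, … [V, W]]]` span the whole space. -/
def BracketSpanning {F : Type*} [NormedAddCommGroup F] [NormedSpace ℝ F] (V W : F → F) (x : F) :
    Prop :=
  ∀ p : F →L[ℝ] ℝ, (∀ k, p (iterLieBracket V W k x) = 0) → p = 0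

theorem span_eq_top_of_forall_continuousLinearMap {F : Type*} [NormedAddCommGroup F]
    [NormedSpace ℝ F] [FiniteDimensional ℝ F] {s : Set F}
    (h : ∀ p : F →L[ℝ] ℝ, (∀ v ∈ s, p v = 0) → p = 0) : Submodule.span ℝ s = ⊤ := by
  by_contra hne
  obtain ⟨q, hq0, hq⟩ := Submodule.exists_le_ker_of_lt_top _ (lt_top_iff_ne_top.2 hne)
  refine hq0 ?_
  have := h (LinearMap.toContinuousLinearMap q) fun v hv => hq (Submodule.subset_span hv)
  simpa using this

theorem ae_ae_bracketSpanning {F : Type*} [NormedAddCommGroup F] [NormedSpace ℝ F]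
    [FiniteDimensional ℝ F] [MeasurableSpace F] [BorelSpace F] (μ : Measure F)
    [μ.IsAddHaarMeasure] {V W : ℝ × F → F} (hV : AnalyticOnNhd ℝ V univ)
    (hW : AnalyticOnNhd ℝ W univ) {δ₀ : ℝ} {x₀ : F}
    (h₀ : BracketSpanning (fun x => V (δ₀, x)) (fun x => W (δ₀, x)) x₀) :
    ∀ᵐ δ : ℝ, ∀ᵐ x ∂μ, BracketSpanning (fun x => V (δ, x)) (fun x => W (δ, x)) x := by
  set B : ℕ → ℝ × F → F := fun k z =>
    iterLieBracket (fun x => V (z.1, x)) (fun x => W (z.1, x)) k z.2 with hB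
  have hBan : ∀ k, AnalyticOnNhd ℝ (B k) univ := by
    intro k z hz
    have h1 := (analyticOnNhd_const (v := (0 : ℝ)).prod hV).iterLieBracket
      (analyticOnNhd_const (v := (0 : ℝ)).prod hW) k z hz
    have h2 := ((ContinuousLinearMap.snd ℝ ℝ F).analyticAt _).comp h1
    have h3 : B k = ⇑(ContinuousLinearMap.snd ℝ ℝ F) ∘
        iterLieBracket (fun z => ((0 : ℝ), V z)) (fun z => ((0 : ℝ), W z)) k := by
      funext z
      simp [hB, iterLieBracket_prod hV hW k z]
    rw [h3]
    exact h2
  have hspan : Submodule.span ℝ (range fun k => B k (δ₀, x₀)) = ⊤ :=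
    span_eq_top_of_forall_continuousLinearMap fun p hp => h₀ p fun k => hp _ ⟨k, rfl⟩
  let b := Module.Basis.ofSpan hspan.ge
  have hbr : ∀ l, ∃ k, B k (δ₀, x₀) = b l := fun l =>
    Module.Basis.ofSpan_subset hspan.ge ⟨l, rfl⟩
  choose κ hκ using hbr
  have := FiniteDimensional.fintypeBasisIndex b
  classical
  set f : ℝ × F → ℝ := fun z => b.det fun l => B (κ l) z with hf
  have hfan : AnalyticOnNhd ℝ f univ := by
    have h1 : f = fun z => ∑ σ : Equiv.Perm _, (Equiv.Perm.sign σ : ℝ) *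
        ∏ l, b.repr (B (κ l) z) (σ l) := by
      funext z
      rw [hf]
      simp only [Module.Basis.det_apply, Matrix.det_apply', Module.Basis.toMatrix_apply]
    rw [h1]
    refine Finset.analyticOnNhd_fun_sum _ fun σ _ => analyticOnNhd_const.mul
      (Finset.analyticOnNhd_fun_prod _ fun l _ => ?_)
    exact ((LinearMap.toContinuousLinearMap (b.coord (σ l))).analyticOnNhd univ).comp
      (hBan (κ l)) (mapsTo_univ _ _)
  have hf0 : f (δ₀, x₀) ≠ 0 := by
    have : (fun l => B (κ l) (δ₀, x₀)) = b := funext hκ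
    simp only [hf, this, Module.Basis.det_self]
    exact one_ne_zero
  have hδ : ∀ᵐ δ : ℝ, f (δ, x₀) ≠ 0 := by
    refine AnalyticOnNhd.ae_ne_zero_of_real (g := fun δ => f (δ, x₀)) (a := δ₀) ?_ hf0
    exact hfan.comp (analyticOnNhd_id.prod analyticOnNhd_const) (mapsTo_univ _ _)
  filter_upwards [hδ] with δ hδ
  have hx : ∀ᵐ x ∂μ, f (δ, x) ≠ 0 := by
    have h1 := AnalyticOnNhd.measure_setOf_eq_zero μ (f := fun x => f (δ, x)) (p := x₀)
      (hfan.comp (analyticOnNhd_const.prod analyticOnNhd_id) (mapsTo_univ _ _)) hδ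
    rw [ae_iff]
    simpa using h1
  filter_upwards [hx] with x hx p hp
  have hu := ((Module.Basis.is_basis_iff_det b).2 (isUnit_iff_ne_zero.2 hx)).2
  ext v
  have hv : v ∈ Submodule.span ℝ (range fun l => B (κ l) (δ, x)) := hu ▸ Submodule.mem_top
  have hle : Submodule.span ℝ (range fun l => B (κ l) (δ, x)) ≤ LinearMap.ker p.toLinearMap := by
    rw [Submodule.span_le]
    rintro _ ⟨l, rfl⟩
    exact hp (κ l)
  exact hle hv

theorem eq_zero_of_sum_exp_eq_zero {ι : Type*} [Fintype ι] {a : ι → ℝ}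
    (ha : Function.Injective a) {c : ι → ℝ} (h : ∀ t : ℝ, ∑ i, c i * Real.exp (a i * t) = 0)
    (i : ι) : c i = 0 := by
  let φ : ι → (Multiplicative ℝ →* ℝ) := fun i =>
    { toFun := fun t => Real.exp (a i * t.toAdd)
      map_one' := by simp
      map_mul' := fun s t => by simp [mul_add, Real.exp_add] }
  have hφ : Function.Injective φ := by
    intro i j hij
    have := DFunLike.congr_fun hij (Multiplicative.ofAdd 1)
    exact ha (by simpa [φ] using this)
  have hli := (linearIndependent_monoidHom (Multiplicative ℝ) ℝ).comp φ hφ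
  refine Fintype.linearIndependent_iff.1 hli c ?_ i
  funext t
  simpa [φ] using h t.toAdd

/-- The vector field whose `j`-th component is `exp ((x₀ + j)²)`. -/
def gaussianField {m : ℕ} (i₀ : Fin m) (x : EuclideanSpace ℝ (Fin m)) :
    EuclideanSpace ℝ (Fin m) :=
  WithLp.toLp 2 fun j => Real.exp ((x i₀ + (j : ℕ)) ^ 2)

theorem analyticOnNhd_gaussianField {m : ℕ} (i₀ : Fin m) :
    AnalyticOnNhd ℝ (gaussianField i₀) univ := by
  have h1 : AnalyticOnNhd ℝ (fun (x : EuclideanSpace ℝ (Fin m)) (j : Fin m) =>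
      Real.exp ((x i₀ + (j : ℕ)) ^ 2)) univ := by
    refine AnalyticOnNhd.pi fun j x _ => ?_
    have : AnalyticAt ℝ (fun x : EuclideanSpace ℝ (Fin m) => x i₀) x :=
      (EuclideanSpace.proj i₀ : EuclideanSpace ℝ (Fin m) →L[ℝ] ℝ).analyticAt x
    fun_prop
  exact ((EuclideanSpace.equiv (Fin m) ℝ).symm.toContinuousLinearMap.analyticOnNhd univ).comp h1
    (mapsTo_univ _ _)

theorem analyticOnNhd_pi_diagonal {G E : Type*} [NormedAddCommGroup G] [NormedSpace ℝ G]
    [NormedAddCommGroup E] [NormedSpace ℝ E] {V : G × E → E} (hV : AnalyticOnNhd ℝ V univ)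
    (ι : Type*) [Fintype ι] :
    AnalyticOnNhd ℝ (fun (z : G × (ι → E)) (i : ι) => V (z.1, z.2 i)) univ := by
  refine AnalyticOnNhd.pi fun i => hV.comp (fun z _ => ?_) (mapsTo_univ _ _)
  exact ((ContinuousLinearMap.fst ℝ G (ι → E)).prod
    ((ContinuousLinearMap.proj i).comp (ContinuousLinearMap.snd ℝ G (ι → E)))).analyticAt z

theorem bracketSpanning_gaussianField {m : ℕ} (i₀ : Fin m) (N : ℕ) :
    ∃ x₀ : Fin N → EuclideanSpace ℝ (Fin m),
      BracketSpanning (fun _ _ => EuclideanSpace.single i₀ (1 : ℝ))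
        (fun (x : Fin N → EuclideanSpace ℝ (Fin m)) i => gaussianField i₀ (x i)) x₀ := by
  refine ⟨fun i => EuclideanSpace.single i₀ ((m * (i : ℕ) : ℕ) : ℝ), fun p hp => ?_⟩
  have hW : AnalyticOnNhd ℝ
      (fun (x : Fin N → EuclideanSpace ℝ (Fin m)) i => gaussianField i₀ (x i)) univ := by
    refine AnalyticOnNhd.pi fun i => (analyticOnNhd_gaussianField i₀).comp (fun x _ => ?_)
      (mapsTo_univ _ _)
    exact (ContinuousLinearMap.proj (R := ℝ) i).analyticAt x
  have h1 := eq_zero_of_iterLieBracket_const hW _ _ p hp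
  let w : Fin N × Fin m → Fin N → EuclideanSpace ℝ (Fin m) := fun q =>
    Pi.single q.1 (EuclideanSpace.single q.2 (1 : ℝ))
  have hdecomp : ∀ y : Fin N → EuclideanSpace ℝ (Fin m), y = ∑ q, y q.1 q.2 • w q := by
    intro y
    funext i
    ext j
    have h : ∀ q : Fin N × Fin m, (y q.1 q.2 • w q) i j = if q = (i, j) then y i j else 0 := by
      rintro ⟨i', j'⟩
      by_cases hi : i = i' <;> by_cases hj : j = j' <;>
        simp [w, hi, hj, eq_comm]
    simp only [Finset.sum_apply, WithLp.ofLp_sum, h, Finset.sum_ite_eq', Finset.mem_univ, if_true]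
  have hpw : ∀ y, p y = ∑ q, y q.1 q.2 * p (w q) := by
    intro y
    conv_lhs => rw [hdecomp y]
    simp [map_sum]
  set a : Fin N × Fin m → ℝ := fun q => ((m * (q.1 : ℕ) + (q.2 : ℕ) : ℕ) : ℝ) with ha
  have hinj : Function.Injective fun q => 2 * a q := by
    rintro ⟨i, j⟩ ⟨i', j'⟩ h
    have h2 : m * (i : ℕ) + (j : ℕ) = m * (i' : ℕ) + (j' : ℕ) := by
      have : a (i, j) = a (i', j') := by simpa using h
      exact Nat.cast_injective this
    have hm : 0 < m := i₀.pos
    have hj : (j : ℕ) = j' := by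
      have := congrArg (· % m) h2
      simpa [Nat.mul_add_mod, Nat.mod_eq_of_lt] using this
    have hi : (i : ℕ) = i' := by
      rw [hj] at h2
      exact Nat.eq_of_mul_eq_mul_left hm (by omega)
    ext <;> assumption
  have h2 : ∀ t : ℝ, ∑ q, (Real.exp (a q ^ 2) * p (w q)) * Real.exp (2 * a q * t) = 0 := by
    intro t
    have h3 := h1 t
    rw [hpw] at h3
    have h4 : ∀ q : Fin N × Fin m, (Real.exp (a q ^ 2) * p (w q)) * Real.exp (2 * a q * t) =
        Real.exp (-t ^ 2) * (Real.exp ((a q + t) ^ 2) * p (w q)) := by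
      intro q
      have : Real.exp (a q ^ 2) * Real.exp (2 * a q * t) =
          Real.exp (-t ^ 2) * Real.exp ((a q + t) ^ 2) := by
        rw [← Real.exp_add, ← Real.exp_add]; ring_nf
      linear_combination p (w q) * this
    simp_rw [h4]
    rw [← Finset.mul_sum]
    refine (congrArg _ (Finset.sum_congr rfl fun q _ => ?_)).trans
      ((congrArg _ h3).trans (mul_zero _))
    simp only [gaussianField, ha, Pi.add_apply, Pi.smul_apply, PiLp.add_apply, PiLp.smul_apply,
      PiLp.single_apply, if_true]
    push_cast
    ring_nf
  have h5 : ∀ q, p (w q) = 0 := fun q => by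
    have := eq_zero_of_sum_exp_eq_zero hinj h2 q
    simpa using this
  ext y
  simp [hpw y, h5]

/-- The Picard–Lindelöf theorem on `[-1, 2]`, with explicit bounds. -/
theorem exists_hasDerivAt_of_lipschitzOnWith {F : Type*} [NormedAddCommGroup F] [NormedSpace ℝ F]
    [CompleteSpace F] {f : ℝ → F → F} {t₀ : ℝ} (ht₀ : t₀ ∈ Icc (0 : ℝ) 1) (x : F) {R L : ℝ}
    {K : NNReal} (hL : 0 ≤ L) (hLR : 2 * L ≤ R)
    (hlip : ∀ t ∈ Icc (-1 : ℝ) 2, LipschitzOnWith K (f t) (Metric.closedBall x R))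
    (hcont : ∀ y, ContinuousOn (fun t => f t y) (Icc (-1 : ℝ) 2))
    (hbound : ∀ t ∈ Icc (-1 : ℝ) 2, ∀ y ∈ Metric.closedBall x R, ‖f t y‖ ≤ L) :
    ∃ X : ℝ → F, X t₀ = x ∧ ∀ t ∈ Ioo (-1 : ℝ) 2, HasDerivAt X (f t (X t)) t := by
  have hR : 0 ≤ R := by linarith
  lift R to NNReal using hR
  lift L to NNReal using hL
  have hP : IsPicardLindelof f (tmin := -1) (tmax := 2)
      ⟨t₀, by linarith [ht₀.1], by linarith [ht₀.2]⟩ x R 0 L K := by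
    refine ⟨hlip, fun y _ => hcont y, hbound, ?_⟩
    have h1 : max (2 - t₀) (t₀ - -1) ≤ 2 := max_le (by linarith [ht₀.1]) (by linarith [ht₀.2])
    have := mul_le_mul_of_nonneg_left h1 L.2
    simp only [NNReal.coe_zero, sub_zero]
    refine le_trans this ?_
    change (L : ℝ) * 2 ≤ _
    linarith
  obtain ⟨X, hX0, hX⟩ := hP.exists_eq_forall_mem_Icc_hasDerivWithinAt₀
  exact ⟨X, hX0, fun t ht => (hX t ⟨ht.1.le, ht.2.le⟩).hasDerivAt (Icc_mem_nhds ht.1 ht.2)⟩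

theorem hasDerivAt_integral_of_continuousOn {F : Type*} [NormedAddCommGroup F] [NormedSpace ℝ F]
    [CompleteSpace F] {c : ℝ → F} (hc : ContinuousOn c (Ioo (-1 : ℝ) 2)) {t : ℝ}
    (ht : t ∈ Icc (0 : ℝ) 1) : HasDerivAt (fun t => ∫ τ in (0 : ℝ)..t, c τ) (c t) t := by
  have ht' : t ∈ Ioo (-1 : ℝ) 2 := ⟨by linarith [ht.1], by linarith [ht.2]⟩
  refine intervalIntegral.integral_hasDerivAt_right ?_
    (hc.stronglyMeasurableAtFilter isOpen_Ioo t ht') (hc.continuousAt (isOpen_Ioo.mem_nhds ht'))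
  refine (hc.mono ?_).intervalIntegrable
  rw [uIcc_of_le ht.1]
  exact fun τ hτ => ⟨by linarith [hτ.1], by linarith [hτ.2, ht.2]⟩

/-- The endpoint map of a control-affine system depends on finitely many control parameters in a
strictly differentiable way, with derivative given by the fundamental solution `Ψ` of the adjoint
linearized equation. -/
theorem exists_hasStrictFDerivAt_endpoint {F : Type*} [NormedAddCommGroup F] [NormedSpace ℝ F]
    [CompleteSpace F] {W₁ W₂ : F → F} {K : NNReal} {M : ℝ} (hK : 0 < K)
    (h₁ : LipschitzWith K W₁) (h₂ : LipschitzWith K W₂)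
    (hM₁ : ∀ x, ‖W₁ x‖ ≤ M) (hM₂ : ∀ x, ‖W₂ x‖ ≤ M)
    (hd : ∀ a x x', ‖W₁ x - W₁ x' - fderiv ℝ W₁ a (x - x')‖ ≤
      K * (‖x - a‖ + ‖x' - a‖) * ‖x - x'‖)
    {u : ℝ → ℝ} (hu : Continuous u) {X₀ : ℝ → F}
    (hX₀ : ∀ t ∈ Ioo (-1 : ℝ) 2, HasDerivAt X₀ (u t • W₁ (X₀ t)) t) {Ψ : ℝ → F →L[ℝ] F}
    (hΨ : ∀ t ∈ Ioo (-1 : ℝ) 2, HasDerivAt Ψ (-(Ψ t ∘L (u t • fderiv ℝ W₁ (X₀ t)))) t)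
    (hΨ1 : Ψ 1 = ContinuousLinearMap.id ℝ F) {n : ℕ} {w : Fin n → ℝ → ℝ}
    (hw : ∀ k, Continuous (w k)) :
    ∃ Φ : (Fin n → ℝ) → F,
      (∀ s, ∃ X : ℝ → F, X 0 = X₀ 0 ∧ X 1 = Φ s ∧ ∀ t ∈ Icc (0 : ℝ) 1,
        HasDerivAt X (u t • W₁ (X t) + (∑ k, s k * w k t) • W₂ (X t)) t) ∧
      Φ 0 = X₀ 1 ∧
      HasStrictFDerivAt Φ (∑ k, (ContinuousLinearMap.proj k : (Fin n → ℝ) →L[ℝ] ℝ).smulRight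
        (∫ t in (0 : ℝ)..1, w k t • Ψ t (W₂ (X₀ t)))) 0 := by
  classical
  set v : (Fin n → ℝ) → ℝ → ℝ := fun s t => ∑ k, s k * w k t with hv
  have hvc : ∀ s, Continuous (v s) := fun s => by fun_prop
  have hvsub : ∀ s s' t, v (s - s') t = v s t - v s' t := fun s s' t => by
    simp [hv, sub_mul, Finset.sum_sub_distrib]
  have hI : ∀ {t : ℝ}, t ∈ Icc (0 : ℝ) 1 → t ∈ Ioo (-1 : ℝ) 2 := fun ht =>
    ⟨by linarith [ht.1], by linarith [ht.2]⟩
  have hM : 0 ≤ M := (norm_nonneg _).trans (hM₁ 0)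
  have hKr : (0 : ℝ) < K := hK
  obtain ⟨β, hβ, hβu, hβv, hβΨ⟩ : ∃ β : ℝ, 1 ≤ β ∧ (∀ t ∈ Icc (-1 : ℝ) 2, ‖u t‖ ≤ β) ∧
      (∀ s, ∀ t ∈ Icc (-1 : ℝ) 2, ‖v s t‖ ≤ β * ‖s‖) ∧ ∀ t ∈ Icc (0 : ℝ) 1, ‖Ψ t‖ ≤ β := by
    obtain ⟨b₁, hb₁⟩ := (isCompact_Icc (a := (-1 : ℝ)) (b := 2)).exists_bound_of_continuousOn
      hu.continuousOn
    have hs : Continuous fun t => ∑ k, ‖w k t‖ := by fun_prop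
    obtain ⟨b₂, hb₂⟩ := (isCompact_Icc (a := (-1 : ℝ)) (b := 2)).exists_bound_of_continuousOn
      hs.continuousOn
    obtain ⟨b₃, hb₃⟩ := (isCompact_Icc (a := (0 : ℝ)) (b := 1)).exists_bound_of_continuousOn
      (f := Ψ) fun t ht => (hΨ t (hI ht)).continuousAt.continuousWithinAt
    refine ⟨max 1 (max b₁ (max b₂ b₃)), le_max_left _ _, fun t ht => (hb₁ t ht).trans (by simp),
      fun s t ht => ?_, fun t ht => (hb₃ t ht).trans (by simp)⟩
    calc ‖v s t‖ ≤ ∑ k, ‖s k * w k t‖ := norm_sum_le _ _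
      _ ≤ ∑ k, ‖w k t‖ * ‖s‖ := by
        refine Finset.sum_le_sum fun k _ => ?_
        rw [norm_mul, mul_comm]
        gcongr
        exact norm_le_pi_norm s k
      _ = (∑ k, ‖w k t‖) * ‖s‖ := by rw [Finset.sum_mul]
      _ ≤ _ := by
        gcongr
        exact ((le_abs_self _).trans (hb₂ t ht)).trans (by simp)
  have hβ0 : 0 < β := by linarith
  have hex : ∀ s, ∃ X : ℝ → F, X 0 = X₀ 0 ∧ ∀ t ∈ Ioo (-1 : ℝ) 2,
      HasDerivAt X (u t • W₁ (X t) + v s t • W₂ (X t)) t := by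
    intro s
    have hc : 0 ≤ β * ‖s‖ := by positivity
    refine exists_hasDerivAt_of_lipschitzOnWith
      (f := fun t y => u t • W₁ y + v s t • W₂ y) (by simp) (X₀ 0)
      (L := β * M + β * ‖s‖ * M) (R := 2 * (β * M + β * ‖s‖ * M))
      (K := β.toNNReal * K + (β * ‖s‖).toNNReal * K) (by positivity) le_rfl ?_ ?_ ?_
    · intro t ht
      refine LipschitzWith.lipschitzOnWith (LipschitzWith.of_dist_le_mul fun x y => ?_)
      have e1 := h₁.dist_le_mul x y
      have e2 := h₂.dist_le_mul x y
      rw [dist_eq_norm] at e1 e2 ⊢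
      have : u t • W₁ x + v s t • W₂ x - (u t • W₁ y + v s t • W₂ y) =
        u t • (W₁ x - W₁ y) + v s t • (W₂ x - W₂ y) := by module
      rw [this]
      refine (norm_add_le _ _).trans ?_
      rw [norm_smul, norm_smul]
      push_cast
      rw [Real.coe_toNNReal _ hβ0.le, Real.coe_toNNReal _ hc, add_mul, mul_assoc, mul_assoc]
      have := hβu t ht
      have := hβv s t ht
      gcongr
    · intro y
      have := hvc s
      fun_prop
    · intro t ht y _
      refine (norm_add_le _ _).trans ?_
      rw [norm_smul, norm_smul]
      have := hβu t ht
      have := hβv s t ht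
      have := hM₁ y
      have := hM₂ y
      gcongr
  choose X hX0 hX using hex
  set C : ℝ := β * M / (2 * β * K) * Real.exp (2 * β * K) with hC
  have hC0 : 0 ≤ C := by positivity
  have gronwall : ∀ {s s' : Fin n → ℝ} {Y Y' : ℝ → F}, ‖s‖ ≤ 1 → Y 0 = Y' 0 →
      (∀ t ∈ Ioo (-1 : ℝ) 2, HasDerivAt Y (u t • W₁ (Y t) + v s t • W₂ (Y t)) t) →
      (∀ t ∈ Ioo (-1 : ℝ) 2, HasDerivAt Y' (u t • W₁ (Y' t) + v s' t • W₂ (Y' t)) t) →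
      ∀ t ∈ Icc (0 : ℝ) 1, ‖Y t - Y' t‖ ≤ C * ‖s - s'‖ := by
    intro s s' Y Y' hs h0 hY hY' t ht
    have hD := fun t (ht : t ∈ Icc (0 : ℝ) 1) => (hY t (hI ht)).sub (hY' t (hI ht))
    have := norm_le_gronwallBound_of_norm_deriv_right_le (f := Y - Y') (δ := 0)
      (K := 2 * β * K) (ε := β * M * ‖s - s'‖) (a := 0) (b := 1)
      (fun t ht => (hD t ht).continuousAt.continuousWithinAt)
      (fun t ht => (hD t ⟨ht.1, ht.2.le⟩).hasDerivWithinAt) (by simp [h0]) (fun t ht => ?_) t ht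
    · refine this.trans ?_
      rw [gronwallBound_of_K_ne_0 (by positivity), hC]
      have e : Real.exp (2 * β * K * (t - 0)) ≤ Real.exp (2 * β * K) := by
        refine Real.exp_le_exp.2 ?_
        have : 0 ≤ 2 * β * (K : ℝ) := by positivity
        nlinarith [ht.2]
      have e' : Real.exp (2 * β * K * (t - 0)) - 1 ≤ Real.exp (2 * β * K) := by linarith
      calc _ = β * M / (2 * β * K) * ‖s - s'‖ * (Real.exp (2 * β * K * (t - 0)) - 1) := by ring
        _ ≤ β * M / (2 * β * K) * ‖s - s'‖ * Real.exp (2 * β * K) := by gcongr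
        _ = _ := by ring
    · have ht' : t ∈ Icc (-1 : ℝ) 2 := ⟨by linarith [ht.1], by linarith [ht.2]⟩
      have e : u t • W₁ (Y t) + v s t • W₂ (Y t) - (u t • W₁ (Y' t) + v s' t • W₂ (Y' t)) =
          u t • (W₁ (Y t) - W₁ (Y' t)) + v s t • (W₂ (Y t) - W₂ (Y' t)) +
            v (s - s') t • W₂ (Y' t) := by rw [hvsub]; module
      rw [e]
      refine (norm_add₃_le).trans ?_
      rw [norm_smul, norm_smul, norm_smul]
      have a1 := h₁.dist_le_mul (Y t) (Y' t)
      have a2 := h₂.dist_le_mul (Y t) (Y' t)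
      rw [dist_eq_norm, dist_eq_norm] at a1 a2
      have a3 := hβu t ht'
      have a4 : ‖v s t‖ ≤ β := (hβv s t ht').trans (mul_le_of_le_one_right hβ0.le hs)
      have a5 := hβv (s - s') t ht'
      have a6 := hM₂ (Y' t)
      calc _ ≤ β * (K * ‖Y t - Y' t‖) + β * (K * ‖Y t - Y' t‖) + β * ‖s - s'‖ * M := by gcongr
        _ = _ := by simp only [Pi.sub_apply]; ring
  have hX₀' : ∀ t ∈ Ioo (-1 : ℝ) 2,
      HasDerivAt X₀ (u t • W₁ (X₀ t) + v 0 t • W₂ (X₀ t)) t := fun t ht => by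
    simpa [hv] using hX₀ t ht
  have hΨc : ContinuousOn Ψ (Ioo (-1 : ℝ) 2) := fun t ht =>
    (hΨ t ht).continuousAt.continuousWithinAt
  have hX₀c : ContinuousOn X₀ (Ioo (-1 : ℝ) 2) := fun t ht =>
    (hX₀ t ht).continuousAt.continuousWithinAt
  have hc : ContinuousOn (fun t => Ψ t (W₂ (X₀ t))) (Ioo (-1 : ℝ) 2) :=
    hΨc.clm_apply (h₂.continuous.comp_continuousOn hX₀c)
  have hcw : ∀ k, ContinuousOn (fun t => w k t • Ψ t (W₂ (X₀ t))) (Ioo (-1 : ℝ) 2) := fun k =>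
    (hw k).continuousOn.smul hc
  set Q : ℝ := β * (β * K * C * C + β * K * C) with hQ
  set T : (Fin n → ℝ) →L[ℝ] F := ∑ k, (ContinuousLinearMap.proj k : (Fin n → ℝ) →L[ℝ] ℝ).smulRight
        (∫ t in (0 : ℝ)..1, w k t • Ψ t (W₂ (X₀ t))) with hT
  have key : ∀ s s' : Fin n → ℝ, ‖s‖ ≤ 1 → ‖s'‖ ≤ 1 →
      ‖X s 1 - X s' 1 - T (s - s')‖ ≤ Q * (‖s‖ + ‖s'‖) * ‖s - s'‖ := by
    intro s s' hs hs'
    set G : ℝ → F := fun t => ∑ k, (s - s') k • ∫ τ in (0 : ℝ)..t, w k τ • Ψ τ (W₂ (X₀ τ)) with hG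
    have hGd : ∀ t ∈ Icc (0 : ℝ) 1, HasDerivAt G (v (s - s') t • Ψ t (W₂ (X₀ t))) t := by
      intro t ht
      have := HasDerivAt.fun_sum (u := Finset.univ) fun k _ =>
        (hasDerivAt_integral_of_continuousOn (hcw k) ht).const_smul ((s - s') k)
      refine this.congr_deriv ?_
      change _ = (∑ k, (s - s') k * w k t) • _
      simp only [Finset.sum_smul, mul_smul]
    have hEd : ∀ t ∈ Icc (0 : ℝ) 1, HasDerivAt (fun t => Ψ t (X s t - X s' t) - G t)
        (Ψ t (u t • (W₁ (X s t) - W₁ (X s' t) - fderiv ℝ W₁ (X₀ t) (X s t - X s' t)) +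
          v (s - s') t • (W₂ (X s t) - W₂ (X₀ t)) + v s' t • (W₂ (X s t) - W₂ (X s' t)))) t := by
      intro t ht
      have := ((hΨ t (hI ht)).clm_apply ((hX s t (hI ht)).sub (hX s' t (hI ht)))).sub (hGd t ht)
      refine this.congr_deriv ?_
      simp only [neg_apply, ContinuousLinearMap.comp_apply, smul_apply, map_add,
        map_sub, map_smul, hvsub, Pi.sub_apply]
      module
    have hb := norm_image_sub_le_of_norm_deriv_le_segment' (a := (0 : ℝ)) (b := 1)
      (C := Q * (‖s‖ + ‖s'‖) * ‖s - s'‖) (fun t ht => (hEd t ht).hasDerivWithinAt)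
      (fun t ht => ?_) 1 (by simp)
    · simpa [hΨ1, hX0, hG, hT] using hb
    · have ht1 : t ∈ Icc (0 : ℝ) 1 := ⟨ht.1, ht.2.le⟩
      have ht' : t ∈ Icc (-1 : ℝ) 2 := ⟨by linarith [ht.1], by linarith [ht.2]⟩
      have g1 := gronwall hs ((hX0 s).trans (hX0 s').symm) (hX s) (hX s') t ht1
      have g2 := gronwall hs (hX0 s) (hX s) hX₀' t ht1
      have g3 := gronwall hs' (hX0 s') (hX s') hX₀' t ht1
      rw [sub_zero] at g2 g3
      have a1 := h₂.dist_le_mul (X s t) (X₀ t)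
      have a2 := h₂.dist_le_mul (X s t) (X s' t)
      rw [dist_eq_norm, dist_eq_norm] at a1 a2
      have a3 := hβu t ht'
      have a4 := hβv s' t ht'
      have a5 := hβv (s - s') t ht'
      have a6 := hd (X₀ t) (X s t) (X s' t)
      refine (ContinuousLinearMap.le_opNorm _ _).trans ?_
      calc _ ≤ β * (β * (K * (C * ‖s‖ + C * ‖s'‖) * (C * ‖s - s'‖)) +
              β * ‖s - s'‖ * (K * (C * ‖s‖)) + β * ‖s'‖ * (K * (C * ‖s - s'‖))) := by
            refine mul_le_mul (hβΨ t ht1) ((norm_add₃_le).trans ?_) (norm_nonneg _) hβ0.le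
            rw [norm_smul, norm_smul, norm_smul]
            gcongr
            · refine a6.trans ?_
              gcongr
            · refine a1.trans ?_
              gcongr
            · refine a2.trans ?_
              gcongr
        _ = _ := by rw [hQ]; ring
  refine ⟨fun s => X s 1, fun s => ⟨X s, hX0 s, rfl, fun t ht => hX s t (hI ht)⟩, ?_, ?_⟩
  · have := gronwall (s := 0) (by simp) (hX0 0) (hX 0) hX₀' 1 (by simp)
    rw [sub_zero, norm_zero, mul_zero] at this
    exact sub_eq_zero.1 (norm_le_zero_iff.1 this)
  · refine .of_isLittleO (Asymptotics.isLittleO_iff.2 fun c hc => ?_)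
    have e1 : ∀ᶠ p : (Fin n → ℝ) × (Fin n → ℝ) in nhds (0, 0), ‖p.1‖ < 1 :=
      (continuous_fst.norm.tendsto' _ _ (by simp)).eventually_lt_const one_pos
    have e2 : ∀ᶠ p : (Fin n → ℝ) × (Fin n → ℝ) in nhds (0, 0), ‖p.2‖ < 1 :=
      (continuous_snd.norm.tendsto' _ _ (by simp)).eventually_lt_const one_pos
    have e3 : ∀ᶠ p : (Fin n → ℝ) × (Fin n → ℝ) in nhds (0, 0), Q * (‖p.1‖ + ‖p.2‖) < c := by
      have : Continuous fun p : (Fin n → ℝ) × (Fin n → ℝ) => Q * (‖p.1‖ + ‖p.2‖) := by fun_prop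
      exact (this.tendsto' _ 0 (by simp)).eventually_lt_const hc
    filter_upwards [e1, e2, e3] with p h1 h2 h3
    refine (key p.1 p.2 h1.le h2.le).trans ?_
    gcongr

/-- A loop of the flow of `W₁` based at `x`, traversed back and forth, together with the
fundamental solution of the adjoint linearized equation along it. -/
theorem exists_loop_adjoint {F : Type*} [NormedAddCommGroup F] [NormedSpace ℝ F]
    [CompleteSpace F] {W₁ : F → F} {K : NNReal} {M : ℝ} (hs : ContDiff ℝ (⊤ : ℕ∞) W₁)
    (h₁ : LipschitzWith K W₁) (hM₁ : ∀ x, ‖W₁ x‖ ≤ M) (x : F) :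
    ∃ (u : ℝ → ℝ) (X₀ : ℝ → F) (Ψ : ℝ → F →L[ℝ] F), ContDiff ℝ (⊤ : ℕ∞) u ∧
      (∀ t ∈ Ioo (1 / 2 : ℝ) 1, u t ≠ 0) ∧ X₀ 0 = x ∧ X₀ 1 = x ∧
      (∀ t ∈ Ioo (-1 : ℝ) 2, HasDerivAt X₀ (u t • W₁ (X₀ t)) t) ∧
      (∀ t ∈ Ioo (-1 : ℝ) 2, HasDerivAt Ψ (-(Ψ t ∘L (u t • fderiv ℝ W₁ (X₀ t)))) t) ∧
      Ψ 1 = ContinuousLinearMap.id ℝ F := by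
  have hM : 0 ≤ M := (norm_nonneg _).trans (hM₁ 0)
  obtain ⟨Y, hY0, hY⟩ := exists_hasDerivAt_of_lipschitzOnWith (f := fun _ y => W₁ y) (t₀ := 0)
    (by simp) x hM le_rfl (fun _ _ => h₁.lipschitzOnWith) (fun _ => continuousOn_const)
    (fun _ _ y _ => hM₁ y)
  set η : ℝ := 1 / (12 * K + 4) with hη
  have hK : (0 : ℝ) ≤ K := K.2
  have hη0 : 0 < η := by positivity
  have hη1 : η * (12 * K + 4) = 1 := by rw [hη]; field_simp
  have hη4 : η ≤ 1 / 4 := by nlinarith [mul_nonneg hη0.le hK]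
  have hθ : ∀ t ∈ Icc (-1 : ℝ) 2, η * (t * (1 - t)) ∈ Ioo (-1 : ℝ) 2 := by
    intro t ht
    have e1 : t * (1 - t) ≤ 1 / 4 := by nlinarith [sq_nonneg (t - 1 / 2)]
    have e2 : -2 ≤ t * (1 - t) := by nlinarith [ht.1, ht.2]
    constructor <;> nlinarith
  have hθd : ∀ t, HasDerivAt (fun t : ℝ => η * (t * (1 - t))) (η * (1 - 2 * t)) t := by
    intro t
    refine (((hasDerivAt_id t).mul ((hasDerivAt_id t).const_sub 1)).const_mul η).congr_deriv ?_
    simp only [id]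
    ring
  set X₀ : ℝ → F := fun t => Y (η * (t * (1 - t))) with hX₀
  have hX₀d : ∀ t ∈ Icc (-1 : ℝ) 2, HasDerivAt X₀ ((η * (1 - 2 * t)) • W₁ (X₀ t)) t :=
    fun t ht => (hY _ (hθ t ht)).scomp t (hθd t)
  have hX₀c : ContinuousOn X₀ (Icc (-1 : ℝ) 2) := fun t ht =>
    (hX₀d t ht).continuousAt.continuousWithinAt
  set A : ℝ → F →L[ℝ] F := fun t => (η * (1 - 2 * t)) • fderiv ℝ W₁ (X₀ t) with hA
  have hAc : ContinuousOn A (Icc (-1 : ℝ) 2) := by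
    have : ContinuousOn (fun t => fderiv ℝ W₁ (X₀ t)) (Icc (-1 : ℝ) 2) :=
      (hs.continuous_fderiv (by simp)).comp_continuousOn hX₀c
    have h2 : Continuous fun t : ℝ => η * (1 - 2 * t) := by fun_prop
    exact h2.continuousOn.smul this
  have hAb : ∀ t ∈ Icc (-1 : ℝ) 2, ‖A t‖ ≤ 1 / 4 := by
    intro t ht
    rw [hA, norm_smul, norm_mul, Real.norm_eq_abs, abs_of_pos hη0]
    have e1 : ‖1 - 2 * t‖ ≤ 3 := by
      rw [Real.norm_eq_abs, abs_le]; constructor <;> linarith [ht.1, ht.2]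
    have e2 := norm_fderiv_le_of_lipschitz ℝ h₁ (x₀ := X₀ t)
    calc _ ≤ η * 3 * K := by gcongr
      _ ≤ 1 / 4 := by nlinarith
  have hlip : ∀ t ∈ Icc (-1 : ℝ) 2, LipschitzOnWith (1 / 4) (fun B : F →L[ℝ] F => -(B ∘L A t))
      (Metric.closedBall (ContinuousLinearMap.id ℝ F) 1) := by
    intro t ht
    refine LipschitzWith.lipschitzOnWith (LipschitzWith.of_dist_le_mul fun B B' => ?_)
    rw [dist_eq_norm, dist_eq_norm, neg_sub_neg, ← ContinuousLinearMap.sub_comp, norm_sub_rev B,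
      mul_comm]
    refine (ContinuousLinearMap.opNorm_comp_le _ _).trans ?_
    have := hAb t ht
    push_cast
    gcongr
  have hbd : ∀ t ∈ Icc (-1 : ℝ) 2, ∀ B ∈ Metric.closedBall (ContinuousLinearMap.id ℝ F) 1,
      ‖-(B ∘L A t)‖ ≤ 1 / 2 := by
    intro t ht B hB
    have e1 : ‖B‖ ≤ 2 := by
      have e2 := norm_le_norm_add_norm_sub' B (ContinuousLinearMap.id ℝ F)
      have e3 := ContinuousLinearMap.norm_id_le (𝕜 := ℝ) (E := F)
      rw [Metric.mem_closedBall, dist_eq_norm] at hB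
      linarith
    rw [norm_neg]
    refine (ContinuousLinearMap.opNorm_comp_le _ _).trans ?_
    calc _ ≤ 2 * (1 / 4 : ℝ) := by
          have := hAb t ht
          gcongr
      _ = _ := by norm_num
  obtain ⟨Ψ, hΨ1, hΨ⟩ := exists_hasDerivAt_of_lipschitzOnWith (f := fun t B => -(B ∘L A t))
    (t₀ := 1) (by simp) (ContinuousLinearMap.id ℝ F) (by norm_num) (by norm_num) hlip
    (fun B => (continuousOn_const.clm_comp hAc).neg) hbd
  refine ⟨fun t => η * (1 - 2 * t), X₀, Ψ, by fun_prop, fun t ht => ?_, by simp [hX₀, hY0],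
    by simp [hX₀, hY0], fun t ht => hX₀d t ⟨ht.1.le, ht.2.le⟩, hΨ, hΨ1⟩
  exact mul_ne_zero hη0.ne' (by linarith [ht.1])

/-- A functional annihilating all first-order endpoint variations annihilates all the brackets. -/
theorem eq_zero_of_forall_integral_eq_zero {F : Type*} [NormedAddCommGroup F] [NormedSpace ℝ F]
    [CompleteSpace F] {W₁ W₂ : F → F} (hs₁ : ContDiff ℝ (⊤ : ℕ∞) W₁)
    (hs₂ : ContDiff ℝ (⊤ : ℕ∞) W₂)
    {u : ℝ → ℝ} {X₀ : ℝ → F} {Ψ : ℝ → F →L[ℝ] F} (hu : ∀ t ∈ Ioo (1 / 2 : ℝ) 1, u t ≠ 0)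
    (hX₀ : ∀ t ∈ Ioo (-1 : ℝ) 2, HasDerivAt X₀ (u t • W₁ (X₀ t)) t)
    (hΨ : ∀ t ∈ Ioo (-1 : ℝ) 2, HasDerivAt Ψ (-(Ψ t ∘L (u t • fderiv ℝ W₁ (X₀ t)))) t)
    (hΨ1 : Ψ 1 = ContinuousLinearMap.id ℝ F) (hW : BracketSpanning W₁ W₂ (X₀ 1))
    (p : F →L[ℝ] ℝ) (hp : ∀ w : ℝ → ℝ, ContDiff ℝ (⊤ : ℕ∞) w →
      p (∫ t in (0 : ℝ)..1, w t • Ψ t (W₂ (X₀ t))) = 0) : p = 0 := by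
  set B := iterLieBracket W₁ W₂ with hB
  have hBs : ∀ k, ContDiff ℝ (⊤ : ℕ∞) (B k) := fun k => hs₁.iterLieBracket hs₂ k
  have hder : ∀ k, ∀ t ∈ Ioo (-1 : ℝ) 2, HasDerivAt (fun t => p (Ψ t (B k (X₀ t))))
      (u t * p (Ψ t (B (k + 1) (X₀ t)))) t := by
    intro k t ht
    have hBd : HasFDerivAt (B k) (fderiv ℝ (B k) (X₀ t)) (X₀ t) :=
      ((hBs k).differentiable (by simp) _).hasFDerivAt
    have := p.hasFDerivAt.comp_hasDerivAt t ((hΨ t ht).clm_apply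
      (hBd.comp_hasDerivAt t (hX₀ t ht)))
    refine this.congr_deriv ?_
    have e : B (k + 1) (X₀ t) = fderiv ℝ (B k) (X₀ t) (W₁ (X₀ t)) -
      fderiv ℝ W₁ (X₀ t) (B k (X₀ t)) := rfl
    simp only [e, neg_apply, ContinuousLinearMap.comp_apply, smul_apply, map_add, map_sub,
      map_smul, map_neg, smul_eq_mul, Function.comp_apply]
    ring
  have hcont : ∀ k, ContinuousOn (fun t => p (Ψ t (B k (X₀ t)))) (Ioo (-1 : ℝ) 2) := fun k t ht =>
    (hder k t ht).continuousAt.continuousWithinAt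
  have hvc : ContinuousOn (fun t => Ψ t (W₂ (X₀ t))) (Ioo (-1 : ℝ) 2) := fun t ht =>
    ((hΨ t ht).continuousAt.clm_apply
      (hs₂.continuous.continuousAt.comp (hX₀ t ht).continuousAt)).continuousWithinAt
  have hsub : Ioo (0 : ℝ) 1 ⊆ Ioo (-1 : ℝ) 2 := Ioo_subset_Ioo (by norm_num) (by norm_num)
  have h0 : ∀ t ∈ Ioo (0 : ℝ) 1, p (Ψ t (B 0 (X₀ t))) = 0 := by
    have hae := isOpen_Ioo.ae_eq_zero_of_integral_contDiff_smul_eq_zero (μ := volume)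
      (((hcont 0).mono hsub).locallyIntegrableOn measurableSet_Ioo) (fun g hg _ hgs => ?_)
    · have hae' : (fun t => p (Ψ t (B 0 (X₀ t)))) =ᵐ[volume.restrict (Ioo (0 : ℝ) 1)] 0 := by
        rw [Filter.EventuallyEq, ae_restrict_iff' measurableSet_Ioo]
        exact hae
      exact Measure.eqOn_open_of_ae_eq hae' isOpen_Ioo ((hcont 0).mono hsub) continuousOn_const
    · have e1 := hp g hg
      rw [← ContinuousLinearMap.intervalIntegral_comp_comm,
        intervalIntegral.integral_of_le zero_le_one] at e1
      · rw [← setIntegral_eq_integral_of_forall_compl_eq_zero (s := Ioc (0 : ℝ) 1)]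
        · simp only [map_smul] at e1
          exact e1
        · intro t ht
          have : g t = 0 := by
            by_contra h
            exact ht (Ioo_subset_Ioc_self (hgs (subset_tsupport _ h)))
          simp [this]
      · refine ContinuousOn.intervalIntegrable (hg.continuous.continuousOn.smul (hvc.mono ?_))
        rw [uIcc_of_le zero_le_one]
        exact fun t ht => ⟨by linarith [ht.1], by linarith [ht.2]⟩
  have hk : ∀ k, ∀ t ∈ Ioo (1 / 2 : ℝ) 1, p (Ψ t (B k (X₀ t))) = 0 := by
    intro k
    induction k with
    | zero => exact fun t ht => h0 t ⟨by linarith [ht.1], ht.2⟩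
    | succ k ih =>
      intro t ht
      have h1 := hder k t ⟨by linarith [ht.1], by linarith [ht.2]⟩
      have h2 : HasDerivAt (fun t => p (Ψ t (B k (X₀ t)))) 0 t :=
        (hasDerivAt_const t (0 : ℝ)).congr_of_eventuallyEq
          (Filter.eventually_of_mem (isOpen_Ioo.mem_nhds ht) ih)
      exact (mul_eq_zero.1 (h1.unique h2)).resolve_left (hu t ht)
  refine hW p fun k => ?_
  have hc := (hder k 1 (by norm_num)).continuousAt.continuousWithinAt (s := Ioo (1 / 2 : ℝ) 1)
  have hne : (nhdsWithin (1 : ℝ) (Ioo (1 / 2 : ℝ) 1)).NeBot :=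
    mem_closure_iff_nhdsWithin_neBot.1 (by rw [closure_Ioo (by norm_num)]; norm_num)
  have h3 := tendsto_nhds_unique_of_eventuallyEq hc tendsto_const_nhds
    (Filter.eventually_of_mem self_mem_nhdsWithin (hk k))
  simpa [hΨ1] using h3

/-- Local controllability of a control-affine system under the bracket condition. -/
theorem eventually_exists_trajectory {F : Type*} [NormedAddCommGroup F] [NormedSpace ℝ F]
    [FiniteDimensional ℝ F] {W₁ W₂ : F → F} {K : NNReal} {M : ℝ} (hK : 0 < K)
    (hs₁ : ContDiff ℝ (⊤ : ℕ∞) W₁) (hs₂ : ContDiff ℝ (⊤ : ℕ∞) W₂)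
    (h₁ : LipschitzWith K W₁) (h₂ : LipschitzWith K W₂)
    (hM₁ : ∀ x, ‖W₁ x‖ ≤ M) (hM₂ : ∀ x, ‖W₂ x‖ ≤ M)
    (hd : ∀ a x x', ‖W₁ x - W₁ x' - fderiv ℝ W₁ a (x - x')‖ ≤
      K * (‖x - a‖ + ‖x' - a‖) * ‖x - x'‖)
    {x : F} (hW : BracketSpanning W₁ W₂ x) :
    ∀ᶠ z in nhds x, ∃ u₁ u₂ : ℝ → ℝ, ContDiff ℝ (⊤ : ℕ∞) u₁ ∧ ContDiff ℝ (⊤ : ℕ∞) u₂ ∧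
      ∃ X : ℝ → F, X 0 = x ∧ X 1 = z ∧ ∀ t ∈ Icc (0 : ℝ) 1,
        HasDerivAt X (u₁ t • W₁ (X t) + u₂ t • W₂ (X t)) t := by
  have : CompleteSpace F := FiniteDimensional.complete ℝ F
  obtain ⟨u, X₀, Ψ, hus, hu, hX0, hX1, hX₀, hΨ, hΨ1⟩ := exists_loop_adjoint hs₁ h₁ hM₁ x
  set S : Set F := {v | ∃ w : ℝ → ℝ, ContDiff ℝ (⊤ : ℕ∞) w ∧
    v = ∫ t in (0 : ℝ)..1, w t • Ψ t (W₂ (X₀ t))} with hS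
  have hspan : Submodule.span ℝ S = ⊤ := span_eq_top_of_forall_continuousLinearMap fun p hp =>
    eq_zero_of_forall_integral_eq_zero hs₁ hs₂ hu hX₀ hΨ hΨ1 (by rwa [hX1]) p
      fun w hw => hp _ ⟨w, hw, rfl⟩
  obtain ⟨f, hfS, hf, -⟩ := Submodule.exists_fun_fin_finrank_span_eq ℝ S
  choose w hw hfw using hfS
  obtain ⟨Φ, hΦ, hΦ0, hΦd⟩ := exists_hasStrictFDerivAt_endpoint hK h₁ h₂ hM₁ hM₂ hd hus.continuous
    hX₀ hΨ hΨ1 (fun k => (hw k).continuous)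
  have hmap := hΦd.map_nhds_eq_of_surj (by
    refine eq_top_iff.2 ((hf.trans hspan).ge.trans (Submodule.span_le.2 ?_))
    rintro _ ⟨k, rfl⟩
    refine ⟨Pi.single k 1, ?_⟩
    simp [hfw k, Finset.sum_apply, Pi.single_apply])
  rw [hΦ0, hX1] at hmap
  rw [← hmap, Filter.eventually_map]
  refine Filter.Eventually.of_forall fun s => ?_
  obtain ⟨X, hXs, hXe, hX⟩ := hΦ s
  exact ⟨u, fun t => ∑ k, s k * w k t, hus, ContDiff.sum fun k _ => contDiff_const.mul (hw k),
    X, hXs.trans hX0, hXe, hX⟩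

theorem ContDiff.exists_bounds_of_hasCompactSupport {E : Type*} [NormedAddCommGroup E]
    [NormedSpace ℝ E] {V : E → E} (hV : ContDiff ℝ (⊤ : ℕ∞) V) (hc : HasCompactSupport V) :
    ∃ (K : NNReal) (M : ℝ), LipschitzWith K V ∧ (∀ x, ‖V x‖ ≤ M) ∧
      ∀ a x x', ‖V x - V x' - fderiv ℝ V a (x - x')‖ ≤
        K * (‖x - a‖ + ‖x' - a‖) * ‖x - x'‖ := by
  obtain ⟨K₁, hK₁⟩ := hV.lipschitzWith_of_hasCompactSupport hc (by simp)
  obtain ⟨K₂, hK₂⟩ := (hV.fderiv_right (m := 1)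
    (by norm_cast)).lipschitzWith_of_hasCompactSupport (hc.fderiv ℝ) (by simp)
  obtain ⟨M, hM⟩ := hc.exists_bound_of_continuous hV.continuous
  refine ⟨max K₁ K₂, M, hK₁.weaken (le_max_left _ _), hM, fun a x x' => ?_⟩
  refine (convex_closedBall a (‖x - a‖ + ‖x' - a‖)).norm_image_sub_le_of_norm_fderiv_le'
    (fun y _ => hV.differentiable (by simp) y) (fun y hy => ?_) ?_ ?_
  · have h := (hK₂.weaken (le_max_right K₁ K₂)).dist_le_mul y a
    rw [dist_eq_norm] at h
    exact h.trans (mul_le_mul_of_nonneg_left hy (NNReal.coe_nonneg _))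
  · simp [dist_eq_norm]
  · simp [dist_eq_norm]

/-- Two compactly supported fields whose diagonal lifts are bracket spanning at a configuration
steer it to every nearby configuration, all points simultaneously. -/
theorem eventually_exists_trajectory_pi {E : Type*} [NormedAddCommGroup E] [NormedSpace ℝ E]
    [FiniteDimensional ℝ E] {V₁ V₂ : E → E} (hs₁ : ContDiff ℝ (⊤ : ℕ∞) V₁)
    (hs₂ : ContDiff ℝ (⊤ : ℕ∞) V₂) (hc₁ : HasCompactSupport V₁) (hc₂ : HasCompactSupport V₂)
    {ι : Type*} [Fintype ι] {x : ι → E}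
    (hx : BracketSpanning (fun (z : ι → E) i => V₁ (z i)) (fun z i => V₂ (z i)) x) :
    ∀ᶠ z in nhds x, ∃ u₁ u₂ : ℝ → ℝ, ContDiff ℝ (⊤ : ℕ∞) u₁ ∧ ContDiff ℝ (⊤ : ℕ∞) u₂ ∧
      ∀ i, ∃ X : ℝ → E, X 0 = x i ∧ X 1 = z i ∧ ∀ t ∈ Icc (0 : ℝ) 1,
        HasDerivAt X (u₁ t • V₁ (X t) + u₂ t • V₂ (X t)) t := by
  obtain ⟨K₁, M₁, hK₁, hM₁, hd₁⟩ := hs₁.exists_bounds_of_hasCompactSupport hc₁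
  obtain ⟨K₂, M₂, hK₂, hM₂, -⟩ := hs₂.exists_bounds_of_hasCompactSupport hc₂
  have hM : 0 ≤ max M₁ M₂ := ((norm_nonneg _).trans (hM₁ 0)).trans (le_max_left _ _)
  have hlift : ∀ {V : E → E}, ContDiff ℝ (⊤ : ℕ∞) V →
      ContDiff ℝ (⊤ : ℕ∞) fun (z : ι → E) i => V (z i) := fun hV =>
    contDiff_pi.2 fun i => hV.comp (contDiff_apply ℝ E i)
  have hlip : ∀ {V : E → E} {K : NNReal}, LipschitzWith K V →
      LipschitzWith K fun (z : ι → E) i => V (z i) := fun {V K} hV =>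
    LipschitzWith.of_dist_le_mul fun z z' =>
      (dist_pi_le_iff (by positivity)).2 fun i => (hV.dist_le_mul _ _).trans
        (mul_le_mul_of_nonneg_left (dist_le_pi_dist z z' i) K.2)
  set K : NNReal := max 1 (max K₁ K₂) with hK
  have hev := eventually_exists_trajectory (K := K) (M := max M₁ M₂)
    (lt_of_lt_of_le one_pos (le_max_left _ _)) (hlift hs₁) (hlift hs₂)
    (hlip (hK₁.weaken (by simp [hK]))) (hlip (hK₂.weaken (by simp [hK])))
    (fun z => (pi_norm_le_iff_of_nonneg hM).2 fun i => (hM₁ _).trans (le_max_left _ _))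
    (fun z => (pi_norm_le_iff_of_nonneg hM).2 fun i => (hM₂ _).trans (le_max_right _ _))
    (fun a z z' => ?_) hx
  · filter_upwards [hev] with z ⟨u₁, u₂, hu₁, hu₂, X, hX0, hX1, hX⟩
    exact ⟨u₁, u₂, hu₁, hu₂, fun i => ⟨fun t => X t i, congrFun hX0 i, congrFun hX1 i,
      fun t ht => hasDerivAt_pi.1 (hX t ht) i⟩⟩
  · have hf : HasFDerivAt (fun (z : ι → E) i => V₁ (z i)) (ContinuousLinearMap.pi fun i =>
        (fderiv ℝ V₁ (a i)).comp (ContinuousLinearMap.proj i)) a :=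
      hasFDerivAt_pi.2 fun i => HasFDerivAt.comp a
        (hs₁.differentiable (by simp) (a i)).hasFDerivAt (hasFDerivAt_apply i a)
    rw [hf.fderiv]
    refine (pi_norm_le_iff_of_nonneg (by positivity)).2 fun i => (hd₁ (a i) (z i) (z' i)).trans ?_
    have h1 : (K₁ : ℝ) ≤ K := by
      have : K₁ ≤ K := by simp [hK]
      exact_mod_cast this
    have h2 := norm_le_pi_norm (z - a) i
    have h3 := norm_le_pi_norm (z' - a) i
    have h4 := norm_le_pi_norm (z - z') i
    simp only [Pi.sub_apply] at h2 h3 h4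
    gcongr

theorem ae_ae_bracketSpanning_pi {E : Type*} [NormedAddCommGroup E] [NormedSpace ℝ E]
    [FiniteDimensional ℝ E] [MeasurableSpace E] [BorelSpace E] {ι : Type*} [Fintype ι]
    (μ : Measure (ι → E)) [μ.IsAddHaarMeasure] {V W : ℝ × E → E} (hV : AnalyticOnNhd ℝ V univ)
    (hW : AnalyticOnNhd ℝ W univ) {δ₀ : ℝ} {x₀ : ι → E}
    (h₀ : BracketSpanning (fun x i => V (δ₀, x i)) (fun x i => W (δ₀, x i)) x₀) :
    ∀ᵐ δ : ℝ, ∀ᵐ x ∂μ, BracketSpanning (fun x i => V (δ, x i)) (fun x i => W (δ, x i)) x :=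
  have : SecondCountableTopology E := secondCountable_of_proper
  ae_ae_bracketSpanning μ (analyticOnNhd_pi_diagonal hV ι) (analyticOnNhd_pi_diagonal hW ι) h₀

theorem AnalyticOnNhd.interpolate {E : Type*} [NormedAddCommGroup E] [NormedSpace ℝ E]
    {P Q : E → E} (hP : AnalyticOnNhd ℝ P univ) (hQ : AnalyticOnNhd ℝ Q univ) :
    AnalyticOnNhd ℝ (fun z : ℝ × E => (1 - z.1) • P z.2 + z.1 • Q z.2) univ :=
  ((analyticOnNhd_const.sub analyticOnNhd_fst).smul
    (hP.comp analyticOnNhd_snd (mapsTo_univ _ _))).add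
    (analyticOnNhd_fst.smul (hQ.comp analyticOnNhd_snd (mapsTo_univ _ _)))

theorem ae_ae_bracketSpanning_interpolate {E : Type*} [NormedAddCommGroup E] [NormedSpace ℝ E]
    [FiniteDimensional ℝ E] [MeasurableSpace E] [BorelSpace E] {ι : Type*} [Fintype ι]
    (μ : Measure (ι → E)) [μ.IsAddHaarMeasure] {P₁ P₂ Q₁ Q₂ : E → E}
    (hP₁ : AnalyticOnNhd ℝ P₁ univ) (hP₂ : AnalyticOnNhd ℝ P₂ univ)
    (hQ₁ : AnalyticOnNhd ℝ Q₁ univ) (hQ₂ : AnalyticOnNhd ℝ Q₂ univ) {x₀ : ι → E}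
    (h₀ : BracketSpanning (fun x i => Q₁ (x i)) (fun x i => Q₂ (x i)) x₀) :
    ∀ᵐ δ : ℝ, ∀ᵐ x ∂μ, BracketSpanning (fun x i => (1 - δ) • P₁ (x i) + δ • Q₁ (x i))
      (fun x i => (1 - δ) • P₂ (x i) + δ • Q₂ (x i)) x := by
  have h₁ : BracketSpanning (fun x i => (1 - (1 : ℝ)) • P₁ (x i) + (1 : ℝ) • Q₁ (x i))
      (fun x i => (1 - (1 : ℝ)) • P₂ (x i) + (1 : ℝ) • Q₂ (x i)) x₀ := by
    simp only [sub_self, zero_smul, one_smul, zero_add]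
    exact h₀
  have h := ae_ae_bracketSpanning_pi (V := fun z => (1 - z.1) • P₁ z.2 + z.1 • Q₁ z.2)
    (W := fun z => (1 - z.1) • P₂ z.2 + z.1 • Q₂ z.2) μ (hP₁.interpolate hQ₁)
    (hP₂.interpolate hQ₂) h₁
  exact h

theorem ae_forall_ae_bracketSpanning_pi {m : ℕ} (i₀ : Fin m)
    {P₁ P₂ : EuclideanSpace ℝ (Fin m) → EuclideanSpace ℝ (Fin m)}
    (hP₁ : AnalyticOnNhd ℝ P₁ univ) (hP₂ : AnalyticOnNhd ℝ P₂ univ) :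
    ∀ᵐ δ : ℝ, ∀ N : ℕ, ∀ᵐ x : Fin N → EuclideanSpace ℝ (Fin m), BracketSpanning
      (fun z i => (1 - δ) • P₁ (z i) + δ • EuclideanSpace.single i₀ (1 : ℝ))
      (fun z i => (1 - δ) • P₂ (z i) + δ • gaussianField i₀ (z i)) x := by
  refine ae_all_iff.2 fun N => ?_
  obtain ⟨x₀, hx₀⟩ := bracketSpanning_gaussianField i₀ N
  have h := ae_ae_bracketSpanning_interpolate (P₁ := P₁) (P₂ := P₂)
    (Q₁ := fun _ => EuclideanSpace.single i₀ (1 : ℝ)) (Q₂ := gaussianField i₀) volume hP₁ hP₂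
    analyticOnNhd_const (analyticOnNhd_gaussianField i₀) hx₀
  exact h

/-- Two continuous fields are uniformly close on a bounded set to analytic fields all of whose
diagonal lifts are bracket spanning almost everywhere. -/
theorem exists_analyticOnNhd_near_bracketSpanning {m : ℕ} (i₀ : Fin m)
    {Ω : Set (EuclideanSpace ℝ (Fin m))} (hΩ : Bornology.IsBounded Ω)
    {V₁ V₂ : EuclideanSpace ℝ (Fin m) → EuclideanSpace ℝ (Fin m)} (h₁ : Continuous V₁)
    (h₂ : Continuous V₂) {ε : ℝ} (hε : 0 < ε) :
    ∃ A₁ A₂ : EuclideanSpace ℝ (Fin m) → EuclideanSpace ℝ (Fin m),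
      AnalyticOnNhd ℝ A₁ univ ∧ AnalyticOnNhd ℝ A₂ univ ∧
      (∀ x ∈ Ω, ‖A₁ x - V₁ x‖ ≤ ε) ∧ (∀ x ∈ Ω, ‖A₂ x - V₂ x‖ ≤ ε) ∧
      ∀ N : ℕ, ∀ᵐ x : Fin N → EuclideanSpace ℝ (Fin m),
        BracketSpanning (fun z i => A₁ (z i)) (fun z i => A₂ (z i)) x := by
  have hcl : IsCompact (closure Ω) := hΩ.isCompact_closure
  obtain ⟨P₁, hP₁, hP₁n⟩ := exists_analyticOnNhd_near hcl h₁ (half_pos hε)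
  obtain ⟨P₂, hP₂, hP₂n⟩ := exists_analyticOnNhd_near hcl h₂ (half_pos hε)
  have hbd : ∀ {P Q : EuclideanSpace ℝ (Fin m) → EuclideanSpace ℝ (Fin m)},
      AnalyticOnNhd ℝ P univ → AnalyticOnNhd ℝ Q univ → ∃ C, ∀ x ∈ closure Ω, ‖Q x - P x‖ ≤ C :=
    fun hP hQ => hcl.exists_bound_of_continuousOn
      ((hQ.continuousOn.sub hP.continuousOn).mono (subset_univ _))
  have hQ₁ : AnalyticOnNhd ℝ (fun _ : EuclideanSpace ℝ (Fin m) =>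
    EuclideanSpace.single i₀ (1 : ℝ)) univ := analyticOnNhd_const
  have hQ₂ := analyticOnNhd_gaussianField i₀
  obtain ⟨C₁, hC₁⟩ := hbd hP₁ hQ₁
  obtain ⟨C₂, hC₂⟩ := hbd hP₂ hQ₂
  set C : ℝ := max 1 (max C₁ C₂) with hC
  have hC0 : 0 < C := lt_of_lt_of_le one_pos (le_max_left _ _)
  have hvol : volume (Ioo 0 (ε / 2 / C)) ≠ 0 := by
    simp only [Real.volume_Ioo, sub_zero, ne_eq, ENNReal.ofReal_eq_zero, not_le]
    positivity
  obtain ⟨δ, hδ, hspan⟩ := Measure.exists_mem_of_measure_ne_zero_of_ae hvol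
    (ae_restrict_of_ae (ae_forall_ae_bracketSpanning_pi i₀ hP₁ hP₂))
  have hδC : δ * C ≤ ε / 2 := ((lt_div_iff₀ hC0).1 hδ.2).le
  have key : ∀ {p q v : EuclideanSpace ℝ (Fin m)}, ‖p - v‖ < ε / 2 → ‖q - p‖ ≤ C →
      ‖(1 - δ) • p + δ • q - v‖ ≤ ε := by
    intro p q v hp hq
    have e : (1 - δ) • p + δ • q - v = (p - v) + δ • (q - p) := by module
    rw [e]
    refine (norm_add_le _ _).trans ?_
    rw [norm_smul, Real.norm_eq_abs, abs_of_pos hδ.1]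
    have := mul_le_mul_of_nonneg_left hq hδ.1.le
    linarith
  refine ⟨fun x => (1 - δ) • P₁ x + δ • EuclideanSpace.single i₀ (1 : ℝ),
    fun x => (1 - δ) • P₂ x + δ • gaussianField i₀ x,
    (analyticOnNhd_const.smul hP₁).add (analyticOnNhd_const.smul hQ₁),
    (analyticOnNhd_const.smul hP₂).add (analyticOnNhd_const.smul hQ₂),
    fun x hx => key (hP₁n x (subset_closure hx)) ((hC₁ x (subset_closure hx)).trans (by simp [hC])),
    fun x hx => key (hP₂n x (subset_closure hx)) ((hC₂ x (subset_closure hx)).trans (by simp [hC])),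
    hspan⟩

/-- given `m ≥ 2`, a bounded open connected `Ω ⊂ ℝ^m`, `d ≥ 5` smooth vector
fields `V̂_1,…,V̂_d` and `ε > 0`, there exist smooth vector fields `V_1,…,V_d` with
`sup_{x∈Ω} ‖V_i(x) − V̂_i(x)‖ < ε` for all `i`, such that the controlled system with the
readout `y = λ(X^x_1 − x)` is a universal interpolator for generic training data: for every
`N` there is a Lebesgue nullset `𝒩_N ⊂ Ω^N` such that every input tuple in `Ω^N ∖ 𝒩_N`
can be matched to any tuple of pairwise distinct targets in `Ω`. -/
theorem generic_universal_interpolator_near_any_fields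
    (m : ℕ) (hm : 2 ≤ m)
    (Ω : Set (EuclideanSpace ℝ (Fin m)))
    (hΩbdd : Bornology.IsBounded Ω) (hΩopen : IsOpen Ω) (hΩconn : IsConnected Ω)
    (d : ℕ) (hd : 5 ≤ d)
    (Vhat : Fin d → EuclideanSpace ℝ (Fin m) → EuclideanSpace ℝ (Fin m))
    (hVhat : ∀ i, ContDiff ℝ (⊤ : ℕ∞) (Vhat i))
    (ε : ℝ) (hε : 0 < ε) :
    ∃ V : Fin d → EuclideanSpace ℝ (Fin m) → EuclideanSpace ℝ (Fin m),
      (∀ i, ContDiff ℝ (⊤ : ℕ∞) (V i)) ∧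
      (∀ i, ∃ C : ℝ, C < ε ∧ ∀ x ∈ Ω, ‖V i x - Vhat i x‖ ≤ C) ∧
      ∀ N : ℕ,
        ∃ 𝒩 : Set (Fin N → EuclideanSpace ℝ (Fin m)), volume 𝒩 = 0 ∧
          𝒩 ⊆ {xbar | ∀ i, xbar i ∈ Ω} ∧
          ∀ xbar : Fin N → EuclideanSpace ℝ (Fin m), (∀ i, xbar i ∈ Ω) → xbar ∉ 𝒩 →
            ∀ y : Fin N → EuclideanSpace ℝ (Fin m), (∀ i, y i ∈ Ω) →
              Function.Injective y →
              MatchesWithReadout V xbar y := by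
  set j₁ : Fin d := ⟨0, by omega⟩ with hj₁
  set j₂ : Fin d := ⟨1, by omega⟩ with hj₂
  have hj : j₁ ≠ j₂ := by simp [hj₁, hj₂]
  obtain ⟨A₁, A₂, hA₁, hA₂, hn₁, hn₂, hspan⟩ := exists_analyticOnNhd_near_bracketSpanning
    ⟨0, by omega⟩ hΩbdd (hVhat j₁).continuous (hVhat j₂).continuous (half_pos hε)
  obtain ⟨R, hR0, hR⟩ := hΩbdd.subset_closedBall_lt 0 0
  let χ : ContDiffBump (0 : EuclideanSpace ℝ (Fin m)) := ⟨R, R + 1, hR0, by linarith⟩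
  have hχ : ∀ x ∈ Ω, χ x = 1 := fun x hx => χ.one_of_mem_closedBall (hR hx)
  have hsmooth : ∀ {A : EuclideanSpace ℝ (Fin m) → EuclideanSpace ℝ (Fin m)},
      AnalyticOnNhd ℝ A univ → ContDiff ℝ (⊤ : ℕ∞) fun x => χ x • A x := fun hA =>
    χ.contDiff.smul (contDiffOn_univ.1 hA.contDiffOn_of_completeSpace)
  have hcpt : ∀ A : EuclideanSpace ℝ (Fin m) → EuclideanSpace ℝ (Fin m),
      HasCompactSupport fun x => χ x • A x := fun A => χ.hasCompactSupport.smul_right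
  set V : Fin d → EuclideanSpace ℝ (Fin m) → EuclideanSpace ℝ (Fin m) := fun j =>
    if j = j₁ then fun x => χ x • A₁ x else if j = j₂ then fun x => χ x • A₂ x else Vhat j with hV
  have hV₁ : V j₁ = fun x => χ x • A₁ x := by simp [hV]
  have hV₂ : V j₂ = fun x => χ x • A₂ x := by simp [hV, hj.symm]
  refine ⟨V, fun j => ?_, fun j => ⟨ε / 2, by linarith, fun x hx => ?_⟩, fun N => ?_⟩
  · simp only [hV]
    split_ifs
    exacts [hsmooth hA₁, hsmooth hA₂, hVhat j]
  · simp only [hV]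
    split_ifs with h h'
    · simpa [hχ x hx, h] using hn₁ x hx
    · simpa [hχ x hx, h'] using hn₂ x hx
    · simpa using (half_pos hε).le
  · refine ⟨{x | (∀ i, x i ∈ Ω) ∧
        ¬ BracketSpanning (fun z i => A₁ (z i)) (fun z i => A₂ (z i)) x},
      measure_mono_null (fun x hx => hx.2) (ae_iff.1 (hspan N)), fun x hx => hx.1, fun x hx hxn y _ _ => ?_⟩
    have hxs : BracketSpanning (fun z i => A₁ (z i)) (fun z i => A₂ (z i)) x := by
      by_contra h
      exact hxn ⟨hx, h⟩
    have hnear : ∀ᶠ z : Fin N → EuclideanSpace ℝ (Fin m) in nhds x, ∀ i, χ (z i) = 1 := by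
      refine Filter.eventually_all.2 fun i => ?_
      filter_upwards [(continuous_apply i).continuousAt.preimage_mem_nhds
        (hΩopen.mem_nhds (hx i))] with z hz using hχ _ hz
    have hcongr : ∀ A : EuclideanSpace ℝ (Fin m) → EuclideanSpace ℝ (Fin m),
        (fun (z : Fin N → EuclideanSpace ℝ (Fin m)) i => χ (z i) • A (z i)) =ᶠ[nhds x]
          fun z i => A (z i) := fun A => by
      filter_upwards [hnear] with z hz
      funext i
      rw [hz i, one_smul]
    have hxV : BracketSpanning (fun (z : Fin N → EuclideanSpace ℝ (Fin m)) i => V j₁ (z i))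
        (fun z i => V j₂ (z i)) x := by
      rw [hV₁, hV₂]
      intro p hp
      refine hxs p fun k => ?_
      rw [← (iterLieBracket_congr (hcongr A₁) (hcongr A₂) k).self_of_nhds]
      exact hp k
    have hev := eventually_exists_trajectory_pi (by rw [hV₁]; exact hsmooth hA₁)
      (by rw [hV₂]; exact hsmooth hA₂) (by rw [hV₁]; exact hcpt A₁) (by rw [hV₂]; exact hcpt A₂) hxV
    have hlim : Filter.Tendsto (fun r : ℝ => x + r • y) (nhdsWithin 0 (Ioi 0)) (nhds x) := by
      have : Continuous fun r : ℝ => x + r • y := by fun_prop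
      exact (this.tendsto' 0 x (by simp)).mono_left nhdsWithin_le_nhds
    obtain ⟨r, ⟨u₁, u₂, hu₁, hu₂, hX⟩, hr⟩ :=
      ((hlim.eventually hev).and self_mem_nhdsWithin).exists
    have hr0 : 0 < r := hr
    refine ⟨r⁻¹, inv_pos.2 hr0, fun j => if j = j₁ then u₁ else if j = j₂ then u₂ else 0,
      fun j => ?_, fun i => ?_⟩
    · dsimp only
      split_ifs
      exacts [hu₁, hu₂, contDiff_const]
    · obtain ⟨X, hX0, hX1, hXd⟩ := hX i
      refine ⟨X, hX0, fun t ht => (hXd t ht).congr_deriv ?_, ?_⟩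
      · rw [Finset.sum_eq_add j₁ j₂ hj (fun j _ hj' => by simp [hj'.1, hj'.2]) (by simp) (by simp)]
        simp [hj.symm]
      · rw [hX1]
        simp [smul_smul, inv_mul_cancel₀ hr0.ne']
end
end

section
/- Let U ⊆ ℝ^n be an open connected set and let f : U → ℝ be a real analytic function that is not identically zero on U. Then the zero set {x ∈ U : f(x) = 0} has Lebesgue measure zero. In particular, a nonnegative real analytic function on U that is not identically zero is strictly positive Lebesgue-almost everywhere on U. -/
open Set MeasureTheory

noncomputable section

/-- The zeros of an analytic function that lie in a convex open set on which the function does not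
vanish identically form a null set: slice along the lines through a point where the function does
not vanish, and average over dilations. -/
lemma addHaar_convex_inter_zero_eq_zero {E : Type*} [NormedAddCommGroup E] [NormedSpace ℝ E]
    [FiniteDimensional ℝ E] [MeasurableSpace E] [BorelSpace E] (μ : Measure E)
    [μ.IsAddHaarMeasure] {f : E → ℝ} {B : Set E} (hB : IsOpen B) (hconv : Convex ℝ B)
    (hf : AnalyticOnNhd ℝ f B) {p : E} (hp : p ∈ B) (hfp : f p ≠ 0) :
    μ {x ∈ B | f x = 0} = 0 := by
  have hZ : MeasurableSet {x ∈ B | f x = 0} := by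
    have hrel := hf.continuousOn.isOpen_inter_preimage hB (isOpen_compl_singleton (x := (0 : ℝ)))
    convert hB.measurableSet.diff hrel.measurableSet using 1
    ext x
    simp +contextual
  have hline : ∀ x : E, ∀ᵐ t : ℝ, p + t • x ∉ {x ∈ B | f x = 0} := by
    intro x
    let T : Set ℝ := (fun t : ℝ ↦ p + t • x) ⁻¹' B
    have hT : IsOpen T := hB.preimage (by fun_prop)
    have hTconv : Convex ℝ T := by
      have : T = AffineMap.lineMap p (p + x) ⁻¹' B := by
        ext t
        simp [T, AffineMap.lineMap_apply, add_comm]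
      rw [this]
      exact hconv.affine_preimage _
    have hg : AnalyticOnNhd ℝ (fun t : ℝ ↦ f (p + t • x)) T := by
      intro t ht
      exact AnalyticAt.fun_comp (f := fun t : ℝ ↦ p + t • x) (hf _ ht) (by fun_prop)
    rcases hg.eqOn_zero_or_eventually_ne_zero_of_preconnected hTconv.isPreconnected with h | h
    · exact absurd (by simpa using h (show (0 : ℝ) ∈ T by simpa [T] using hp)) hfp
    · have hae := ae_restrict_le_codiscreteWithin (μ := volume) hT.measurableSet h
      filter_upwards [(ae_restrict_iff' hT.measurableSet).1 hae] with t ht hz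
      exact ht hz.1 hz.2
  have hmeas : MeasurableSet {q : E × ℝ | p + q.2 • q.1 ∉ {x ∈ B | f x = 0}} :=
    hZ.compl.preimage (f := fun q : E × ℝ ↦ p + q.2 • q.1) (by fun_prop)
  have hdil : ∀ᵐ t : ℝ, ∀ᵐ x ∂μ, p + t • x ∉ {x ∈ B | f x = 0} :=
    (Measure.ae_ae_comm hmeas).1 (Filter.Eventually.of_forall hline)
  obtain ⟨t, ht, ht0⟩ := (hdil.and (Measure.ae_ne volume (0 : ℝ))).exists
  have hnull : μ ((t • ·) ⁻¹' ((p + ·) ⁻¹' {x ∈ B | f x = 0})) = 0 := by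
    simpa [ae_iff] using ht
  rw [Measure.addHaar_preimage_smul μ ht0, measure_preimage_add, mul_eq_zero] at hnull
  exact hnull.resolve_left (by simp [ht0])

/-- The zero set of an analytic function on an open preconnected set is null, unless the function
vanishes identically there. -/
lemma AnalyticOnNhd.addHaar_zero_eq_zero {E : Type*} [NormedAddCommGroup E] [NormedSpace ℝ E]
    [FiniteDimensional ℝ E] [MeasurableSpace E] [BorelSpace E] (μ : Measure E)
    [μ.IsAddHaarMeasure] {f : E → ℝ} {U : Set E} (hf : AnalyticOnNhd ℝ f U) (hU : IsOpen U)
    (hUconn : IsPreconnected U) (hne : ¬ EqOn f 0 U) :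
    μ {x ∈ U | f x = 0} = 0 := by
  refine measure_null_of_locally_null _ fun z hz ↦ ?_
  obtain ⟨r, hr, hrU⟩ := Metric.isOpen_iff.1 hU z hz.1
  obtain ⟨p, hp, hfp⟩ : ∃ p ∈ Metric.ball z r, f p ≠ 0 := by
    by_contra! h
    exact hne (hf.eqOn_zero_of_preconnected_of_eventuallyEq_zero hUconn hz.1
      (Filter.eventually_of_mem (Metric.ball_mem_nhds z hr) h))
  refine ⟨{x ∈ Metric.ball z r | f x = 0}, ?_, addHaar_convex_inter_zero_eq_zero μ
    Metric.isOpen_ball (convex_ball z r) (hf.mono hrU) hp hfp⟩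
  filter_upwards [self_mem_nhdsWithin, mem_nhdsWithin_of_mem_nhds (Metric.ball_mem_nhds z hr)]
    with x hx hxr using ⟨hxr, hx.2⟩

/-- a real analytic function on an open connected set `U ⊆ ℝ^n` that is not
identically zero has a zero set of Lebesgue measure zero.  In particular, a nonnegative
real analytic function on `U` that is not identically zero is strictly positive
Lebesgue-almost everywhere on `U`. -/
theorem analytic_zero_set_null
    (n : ℕ)
    (U : Set (EuclideanSpace ℝ (Fin n)))
    (hUopen : IsOpen U) (hUconn : IsConnected U)
    (f : EuclideanSpace ℝ (Fin n) → ℝ)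
    (hf : AnalyticOnNhd ℝ f U)
    (hne : ¬ (∀ x ∈ U, f x = 0)) :
    volume {x ∈ U | f x = 0} = 0 ∧
    ((∀ x ∈ U, 0 ≤ f x) → ∀ᵐ x ∂(volume.restrict U), 0 < f x) := by
  have hnull := hf.addHaar_zero_eq_zero volume hUopen hUconn.isPreconnected hne
  refine ⟨hnull, fun hnonneg ↦ (ae_restrict_iff' hUopen.measurableSet).2 ?_⟩
  filter_upwards [measure_eq_zero_iff_ae_notMem.1 hnull] with x hx hxU
  exact (hnonneg x hxU).lt_of_ne' fun h ↦ hx ⟨hxU, h⟩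
end
end
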